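/- There is no three times continuously differentiable function h : [log 2, ∞) → ℝ such that h'(r) > 0 for all r ≥ log 2, h(r) → +∞ as r → +∞, and the derivative of r ↦ h''(r) − h'(r) − h(r) is at least 2 h(r) h'(r) for all r ≥ log 2. -/

import Mathlib

open Filter

lemma mono_aux (f f' : ℝ → ℝ) (R : ℝ) (hf : ∀ x, R ≤ x → HasDerivAt f (f' x) x)
    (hn : ∀ x, R ≤ x → 0 ≤ f' x) : ∀ x, R ≤ x → f R ≤ f x := by
  intro x hx
  have hm : MonotoneOn f (Set.Ici R) := by
    apply monotoneOn_of_deriv_nonneg (convex_Ici R)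
    · intro y hy
      exact (hf y hy).continuousAt.continuousWithinAt
    · intro y hy
      rw [interior_Ici] at hy
      exact (hf y (le_of_lt hy)).differentiableAt.differentiableWithinAt
    · intro y hy
      rw [interior_Ici] at hy
      rw [(hf y (le_of_lt hy)).deriv]
      exact hn y (le_of_lt hy)
  exact hm (Set.mem_Ici.2 le_rfl) hx hx

/-- There is no `C³` function `h : [log 2, ∞) → ℝ` with `h' > 0` on
`[log 2, ∞)`, `h(r) → +∞` as `r → +∞`, and `(h'' − h' − h)' ≥ 2hh'` on `[log 2, ∞)`. -/
theorem stmt8 (h h' h'' h''' : ℝ → ℝ)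
    (hh : ∀ r ∈ Set.Ici (Real.log 2), HasDerivWithinAt h (h' r) (Set.Ici (Real.log 2)) r)
    (hh' : ∀ r ∈ Set.Ici (Real.log 2), HasDerivWithinAt h' (h'' r) (Set.Ici (Real.log 2)) r)
    (hh'' : ∀ r ∈ Set.Ici (Real.log 2), HasDerivWithinAt h'' (h''' r) (Set.Ici (Real.log 2)) r)
    (hh''' : ContinuousOn h''' (Set.Ici (Real.log 2)))
    (hpos : ∀ r ∈ Set.Ici (Real.log 2), 0 < h' r)
    (htop : Tendsto h atTop atTop)
    (hineq : ∀ r ∈ Set.Ici (Real.log 2),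
      2 * h r * h' r ≤ h''' r - h'' r - h' r) :
    False := by
  obtain ⟨A, hA⟩ : ∃ A, A = Real.log 2 + 1 := ⟨_, rfl⟩
  have mem : ∀ r, A ≤ r → r ∈ Set.Ici (Real.log 2) := fun r hr => by
    rw [Set.mem_Ici]; linarith
  have nb : ∀ r, A ≤ r → Set.Ici (Real.log 2) ∈ nhds r := fun r hr =>
    Ici_mem_nhds (by linarith)
  have d0 : ∀ r, A ≤ r → HasDerivAt h (h' r) r := fun r hr =>
    (hh r (mem r hr)).hasDerivAt (nb r hr)
  have d1 : ∀ r, A ≤ r → HasDerivAt h' (h'' r) r := fun r hr =>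
    (hh' r (mem r hr)).hasDerivAt (nb r hr)
  have d2 : ∀ r, A ≤ r → HasDerivAt h'' (h''' r) r := fun r hr =>
    (hh'' r (mem r hr)).hasDerivAt (nb r hr)
  have hF := mono_aux (fun r => h'' r - h' r - h r - h r ^ 2) _ A
    (fun r hr => (((d2 r hr).sub (d1 r hr)).sub (d0 r hr)).sub ((d0 r hr).pow 2))
    (fun r hr => by
      have := hineq r (mem r hr)
      norm_num
      linarith)
  obtain ⟨C, hC⟩ : ∃ C, C = h'' A - h' A - h A - h A ^ 2 := ⟨_, rfl⟩
  obtain ⟨B, hB⟩ := eventually_atTop.1 (htop.eventually_ge_atTop (-C))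
  obtain ⟨R, hR⟩ : ∃ R, R = max A B := ⟨_, rfl⟩
  have hRA : A ≤ R := hR ▸ le_max_left _ _
  have hRB : B ≤ R := hR ▸ le_max_right _ _
  have h2 : ∀ r, R ≤ r → h r ^ 2 ≤ h'' r := fun r hr => by
    have e1 := hF r (hRA.trans hr)
    have e2 := hB r (hRB.trans hr)
    have e3 := hpos r (mem r (hRA.trans hr))
    linarith
  have hE := mono_aux (fun r => h' r ^ 2 - (2 / 3) * h r ^ 3) _ R
    (fun r hr => ((d1 r (hRA.trans hr)).pow 2).sub (((d0 r (hRA.trans hr)).pow 3).const_mul (2 / 3)))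
    (fun r hr => by
      have e1 := h2 r hr
      have e3 := hpos r (mem r (hRA.trans hr))
      norm_num
      nlinarith)
  obtain ⟨D, hD⟩ : ∃ D, D = h' R ^ 2 - (2 / 3) * h R ^ 3 := ⟨_, rfl⟩
  obtain ⟨S', hS'⟩ := eventually_atTop.1 (htop.eventually_ge_atTop (max 1 (-3 * D)))
  obtain ⟨S, hS⟩ : ∃ S, S = max R S' := ⟨_, rfl⟩
  have hSR : R ≤ S := hS ▸ le_max_left _ _
  have hSS : S' ≤ S := hS ▸ le_max_right _ _
  have h1 : ∀ r, S ≤ r → 1 ≤ h r := fun r hr => (le_max_left _ _).trans (hS' r (hSS.trans hr))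
  have h3 : ∀ r, S ≤ r → h r * √(h r) / 2 ≤ h' r := fun r hr => by
    have e1 := hE r (hSR.trans hr)
    have e2 := h1 r hr
    have e3 := hpos r (mem r (hRA.trans (hSR.trans hr)))
    have e4 : -3 * D ≤ h r := (le_max_right _ _).trans (hS' r (hSS.trans hr))
    have e5 : h r ≤ h r ^ 3 := le_self_pow₀ e2 (by norm_num)
    apply le_of_sq_le_sq _ e3.le
    have : (h r * √(h r) / 2) ^ 2 = h r ^ 3 / 4 := by
      rw [div_pow, mul_pow, Real.sq_sqrt (by linarith)]; ring
    rw [this]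
    linarith
  have hU := mono_aux (fun r => -(√(h r))⁻¹ - r / 4) _ S
    (fun r hr => (((((d0 r (hRA.trans (hSR.trans hr))).sqrt
      (by have := h1 r hr; linarith)).inv
      (by have := h1 r hr; positivity)).neg).sub ((hasDerivAt_id r).div_const 4)))
    (fun r hr => by
      have e1 := h3 r hr
      have e2 := h1 r hr
      have e0 : 0 < h r := by linarith
      have e3 : 0 < √(h r) := Real.sqrt_pos.2 e0
      rw [Real.sq_sqrt e0.le, neg_div, neg_neg, div_div, sub_nonneg,
        div_le_div_iff₀ (by norm_num) (by positivity)]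
      nlinarith)
  have hp : 0 ≤ (√(h S))⁻¹ := by positivity
  have e := hU (S + 4 * (√(h S))⁻¹ + 4) (by linarith)
  have hq : 0 ≤ (√(h (S + 4 * (√(h S))⁻¹ + 4)))⁻¹ := by positivity
  linarith
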